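/- Fix T > 0, d, m ∈ ℕ, L ≥ 0, a continuous map a : ℝ × EuclideanSpace ℝ (Fin d) → EuclideanSpace ℝ (Fin d) satisfying ‖a(t,x) - a(t,y)‖ ≤ L * ‖x - y‖ for all t ∈ [0,T] and all x, y, and a continuous linear map b : EuclideanSpace ℝ (Fin m) → EuclideanSpace ℝ (Fin d). Let B¹, B² : ℝ → EuclideanSpace ℝ (Fin m) be continuous paths, x0¹, x0² ∈ EuclideanSpace ℝ (Fin d), and suppose X¹, X² are continuous on [0,T] with Xⁱ t = x0ⁱ + ∫_0^t a(s, Xⁱ s) ds + b (Bⁱ t - Bⁱ 0) for all t ∈ [0,T], i = 1, 2. Then for every t ∈ [0,T], ‖X¹ t - X² t‖ ≤ (‖x0¹ - x0²‖ + 2 * ‖b‖ * sup_{s ∈ [0,T]} ‖(B¹ s - B¹ 0) - (B² s - B² 0)‖) * exp(L * t). In particular, the solution map F sending the pair (initial value, driving path) to the solution is Lipschitz continuous in the supremum norm. -/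

import Mathlib

open Real intervalIntegral

/-- **Grönwall's inequality**, integral form: a continuous function on `[a, b]` satisfying
`u t ≤ C + K ∫_a^t u` is bounded by `C exp (K (t - a))`. -/
theorem le_mul_exp_of_le_add_mul_integral {u : ℝ → ℝ} {C K a b : ℝ} (hK : 0 ≤ K)
    (hu : ContinuousOn u (Set.Icc a b))
    (h : ∀ t ∈ Set.Icc a b, u t ≤ C + K * ∫ s in a..t, u s) :
    ∀ t ∈ Set.Icc a b, u t ≤ C * Real.exp (K * (t - a)) := by
  intro t ht
  have hab : a ≤ b := ht.1.trans ht.2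
  have hint : MeasureTheory.IntegrableOn u (Set.uIcc a b) := by
    rw [Set.uIcc_of_le hab]
    exact hu.integrableOn_Icc
  have hcont : ContinuousOn (fun t => C + K * ∫ s in a..t, u s) (Set.Icc a b) := by
    have := continuousOn_primitive_interval hint
    rw [Set.uIcc_of_le hab] at this
    exact continuousOn_const.add (continuousOn_const.mul this)
  have hderiv : ∀ x ∈ Set.Ico a b,
      HasDerivWithinAt (fun t => C + K * ∫ s in a..t, u s) (K * u x) (Set.Ici x) x := by
    intro x hx
    have hmem : Set.Icc a b ∈ nhdsWithin x (Set.Ioi x) := Icc_mem_nhdsGT_of_mem hx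
    have hux : ContinuousWithinAt u (Set.Ioi x) x :=
      (hu x (Set.Ico_subset_Icc_self hx)).mono_of_mem_nhdsWithin hmem
    refine ((integral_hasDerivWithinAt_right ?_ ?_ hux).const_mul K).const_add C
    · refine (hu.mono ?_).intervalIntegrable
      rw [Set.uIcc_of_le hx.1]
      exact Set.Icc_subset_Icc_right hx.2.le
    · exact ⟨Set.Icc a b, hmem, hu.aestronglyMeasurable measurableSet_Icc⟩
  calc u t ≤ C + K * ∫ s in a..t, u s := h t ht
    _ ≤ gronwallBound C K 0 (t - a) := by
      refine le_gronwallBound_of_liminf_deriv_right_le hcont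
        (fun x hx r hr => (hderiv x hx).liminf_right_slope_le hr) (by simp) ?_ t ht
      intro x hx
      rw [add_zero]
      exact mul_le_mul_of_nonneg_left (h x (Set.Ico_subset_Icc_self hx)) hK
    _ = C * Real.exp (K * (t - a)) := gronwallBound_ε0 C K (t - a)

/-- Lipschitz stability of the solution map `F : (x0, B) ↦ X` of the additive-noise SDE
`dX_t = a(t, X_t) dt + b dB_t` with Lipschitz drift: if `Xⁱ` solves the integral equation
driven by `Bⁱ` with initial value `x0ⁱ` (`i = 1, 2`), then on `[0,T]`,
`‖X¹ t - X² t‖ ≤ (‖x0¹ - x0²‖ + 2 ‖b‖ sup_{s ∈ [0,T]} ‖(B¹ s - B¹ 0) - (B² s - B² 0)‖) exp(L t)`. -/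
theorem sde_solution_map_lipschitz
    (T : ℝ) (hT : 0 < T) (d m : ℕ) (L : ℝ) (hL : 0 ≤ L)
    (a : ℝ × EuclideanSpace ℝ (Fin d) → EuclideanSpace ℝ (Fin d)) (ha : Continuous a)
    (haL : ∀ t ∈ Set.Icc (0:ℝ) T, ∀ x y : EuclideanSpace ℝ (Fin d),
      ‖a (t, x) - a (t, y)‖ ≤ L * ‖x - y‖)
    (b : EuclideanSpace ℝ (Fin m) →L[ℝ] EuclideanSpace ℝ (Fin d))
    (B₁ B₂ : ℝ → EuclideanSpace ℝ (Fin m)) (hB₁ : Continuous B₁) (hB₂ : Continuous B₂)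
    (x0₁ x0₂ : EuclideanSpace ℝ (Fin d))
    (X₁ X₂ : ℝ → EuclideanSpace ℝ (Fin d))
    (hX₁c : ContinuousOn X₁ (Set.Icc 0 T)) (hX₂c : ContinuousOn X₂ (Set.Icc 0 T))
    (hX₁ : ∀ t ∈ Set.Icc (0:ℝ) T,
      X₁ t = x0₁ + (∫ s in (0:ℝ)..t, a (s, X₁ s)) + b (B₁ t - B₁ 0))
    (hX₂ : ∀ t ∈ Set.Icc (0:ℝ) T,
      X₂ t = x0₂ + (∫ s in (0:ℝ)..t, a (s, X₂ s)) + b (B₂ t - B₂ 0)) :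
    ∀ t ∈ Set.Icc (0:ℝ) T,
      ‖X₁ t - X₂ t‖ ≤
        (‖x0₁ - x0₂‖ +
            2 * ‖b‖ *
              sSup ((fun s => ‖(B₁ s - B₁ 0) - (B₂ s - B₂ 0)‖) '' Set.Icc (0:ℝ) T)) *
          Real.exp (L * t) := by
  set S := sSup ((fun s => ‖(B₁ s - B₁ 0) - (B₂ s - B₂ 0)‖) '' Set.Icc (0:ℝ) T)
  have hS : ∀ t ∈ Set.Icc (0:ℝ) T, ‖(B₁ t - B₁ 0) - (B₂ t - B₂ 0)‖ ≤ S := fun t ht =>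
    le_csSup (isCompact_Icc.image (by fun_prop)).bddAbove (Set.mem_image_of_mem _ ht)
  have hS0 : 0 ≤ S := (norm_nonneg _).trans (hS 0 ⟨le_rfl, hT.le⟩)
  have hbS : 0 ≤ ‖b‖ * S := mul_nonneg (norm_nonneg b) hS0
  have hdiff : ContinuousOn (fun s => ‖X₁ s - X₂ s‖) (Set.Icc 0 T) := (hX₁c.sub hX₂c).norm
  have hint : ∀ {X : ℝ → EuclideanSpace ℝ (Fin d)}, ContinuousOn X (Set.Icc 0 T) →
      ∀ t ∈ Set.Icc (0:ℝ) T,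
        IntervalIntegrable (fun s => a (s, X s)) MeasureTheory.volume 0 t := by
    intro X hX t ht
    refine ContinuousOn.intervalIntegrable ?_
    rw [Set.uIcc_of_le ht.1]
    exact ha.comp_continuousOn
      (continuousOn_id.prodMk (hX.mono (Set.Icc_subset_Icc_right ht.2)))
  have hbound : ∀ t ∈ Set.Icc (0:ℝ) T,
      ‖X₁ t - X₂ t‖ ≤ (‖x0₁ - x0₂‖ + 2 * ‖b‖ * S) + L * ∫ s in (0:ℝ)..t, ‖X₁ s - X₂ s‖ := by
    intro t ht
    have hdrift : ‖∫ s in (0:ℝ)..t, (a (s, X₁ s) - a (s, X₂ s))‖ ≤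
        L * ∫ s in (0:ℝ)..t, ‖X₁ s - X₂ s‖ := by
      rw [← integral_const_mul]
      refine norm_integral_le_of_norm_le ht.1 ?_ ?_
      · exact Filter.Eventually.of_forall fun s hs => haL s ⟨hs.1.le, hs.2.trans ht.2⟩ _ _
      · refine ContinuousOn.intervalIntegrable ?_
        rw [Set.uIcc_of_le ht.1]
        exact continuousOn_const.mul (hdiff.mono (Set.Icc_subset_Icc_right ht.2))
    have hnoise : ‖b ((B₁ t - B₁ 0) - (B₂ t - B₂ 0))‖ ≤ ‖b‖ * S :=
      b.le_opNorm_of_le (hS t ht)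
    have hdecomp : X₁ t - X₂ t = (x0₁ - x0₂) + (∫ s in (0:ℝ)..t, (a (s, X₁ s) - a (s, X₂ s)))
        + b ((B₁ t - B₁ 0) - (B₂ t - B₂ 0)) := by
      rw [hX₁ t ht, hX₂ t ht, integral_sub (hint hX₁c t ht) (hint hX₂c t ht),
        map_sub b (B₁ t - B₁ 0)]
      abel
    rw [hdecomp]
    have htri := norm_add₃_le (a := x0₁ - x0₂)
      (b := ∫ s in (0:ℝ)..t, (a (s, X₁ s) - a (s, X₂ s)))
      (c := b ((B₁ t - B₁ 0) - (B₂ t - B₂ 0)))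
    linarith
  simpa only [sub_zero] using le_mul_exp_of_le_add_mul_integral hL hdiff hbound
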